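/- There exists a locally integrable function b : ℝ² → ℝ such that b ∈ BMO(ℝ²), i.e. sup over squares Q of (1/|Q|)∫_Q |b − b_Q| dA is finite, but ‖b‖_{BMO,∞} = ess sup_y ‖b(·, y)‖_{BMO(ℝ)} = ∞. -/

import Mathlib

open MeasureTheory Set Filter
open scoped ENNReal

noncomputable section

/-- The average `g_I = |I|⁻¹ ∫_I g` over the interval `I = [u, v]`. -/
def avg1 (g : ℝ → ℝ) (u v : ℝ) : ℝ := (v - u)⁻¹ * ∫ x in Icc u v, g x

/-- The mean oscillation `|I|⁻¹ ∫_I |g - g_I|` over `I = [u, v]`. -/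
def osc1 (g : ℝ → ℝ) (u v : ℝ) : ℝ :=
  (v - u)⁻¹ * ∫ x in Icc u v, |g x - avg1 g u v|

/-- The `BMO(ℝ)` norm of `g`: the supremum of mean oscillations over all intervals
(as an extended real, so that `bmo1 g = ∞` means `g ∉ BMO(ℝ)`). -/
def bmo1 (g : ℝ → ℝ) : ℝ≥0∞ :=
  ⨆ (u : ℝ) (v : ℝ) (_ : u < v), ENNReal.ofReal (osc1 g u v)

/-- The axis-parallel square `Q = [a, a+l] × [c, c+l]`. -/
def square (a c l : ℝ) : Set (ℝ × ℝ) := Icc a (a + l) ×ˢ Icc c (c + l)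

/-- The average `b_Q = |Q|⁻¹ ∫_Q b` over the square `Q = [a, a+l] × [c, c+l]`. -/
def avg2 (b : ℝ × ℝ → ℝ) (a c l : ℝ) : ℝ :=
  (volume (square a c l)).toReal⁻¹ * ∫ p in square a c l, b p

/-- The mean oscillation `|Q|⁻¹ ∫_Q |b - b_Q| dA` over the square `Q = [a,a+l] × [c,c+l]`. -/
def osc2 (b : ℝ × ℝ → ℝ) (a c l : ℝ) : ℝ :=
  (volume (square a c l)).toReal⁻¹ * ∫ p in square a c l, |b p - avg2 b a c l|

/-- The planar `BMO(ℝ²)` norm: supremum of mean oscillations over all axis-parallel squares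
(as an extended real, so that `bmo2 b = ∞` means `b ∉ BMO(ℝ²)`). -/
def bmo2 (b : ℝ × ℝ → ℝ) : ℝ≥0∞ :=
  ⨆ (a : ℝ) (c : ℝ) (l : ℝ) (_ : 0 < l), ENNReal.ofReal (osc2 b a c l)

/-- `‖b‖_{BMO,∞} = ess sup_y ‖b(·, y)‖_{BMO(ℝ)}`. -/
def bmoInf (b : ℝ × ℝ → ℝ) : ℝ≥0∞ :=
  essSup (fun y : ℝ => bmo1 fun x => b (x, y)) volume

/-- The even function `log⁺ (1 / |y|)`, cut off to `[-1, 1]`. -/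
def logCusp : ℝ → ℝ := (Icc (-1) 1).indicator fun y => -Real.log y

lemma integrable_logCusp : Integrable logCusp := by
  have h : IntervalIntegrable Real.log volume (-1) 1 := intervalIntegral.intervalIntegrable_log'
  rw [intervalIntegrable_iff_integrableOn_Icc_of_le (by norm_num)] at h
  exact (integrable_indicator_iff measurableSet_Icc).2 h.neg

lemma abs_mul_log_sub_log_le {c M : ℝ} (hM : 0 < M) (hc : |c| ≤ M) :
    |c * (Real.log M - Real.log c)| ≤ M - |c| := by
  rcases eq_or_ne c 0 with rfl | h0
  · simpa using hM.le
  have hpos : 0 < |c| := abs_pos.2 h0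
  rw [abs_mul, ← Real.log_abs c, ← Real.log_div hM.ne' hpos.ne',
    abs_of_nonneg (Real.log_nonneg ((one_le_div hpos).2 hc))]
  calc |c| * Real.log (M / |c|) ≤ |c| * (M / |c| - 1) :=
        mul_le_mul_of_nonneg_left (Real.log_le_sub_one_of_pos (by positivity)) hpos.le
    _ = M - |c| := by field_simp

lemma integral_log_sub_log_le {c l : ℝ} (hl : 0 < l) :
    ∫ y in Icc c (c + l), (Real.log (max |c| |c + l|) - Real.log y) ≤ 2 * l := by
  set M := max |c| |c + l| with hMdef
  have hM : 0 < M := by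
    rcases eq_or_ne c 0 with rfl | h0
    · exact lt_max_of_lt_right (by simpa using hl.ne')
    · exact lt_max_of_lt_left (abs_pos.2 h0)
  rw [integral_Icc_eq_integral_Ioc, ← intervalIntegral.integral_of_le (by linarith),
    intervalIntegral.integral_sub (by simp) intervalIntegral.intervalIntegrable_log',
    integral_log, intervalIntegral.integral_const, smul_eq_mul]
  have h1 := abs_mul_log_sub_log_le hM (le_max_left |c| |c + l|)
  have h2 := abs_mul_log_sub_log_le hM (le_max_right |c| |c + l|)
  have hd1 : |c + l| ≤ |c| + l := (abs_add_le c l).trans (by rw [abs_of_pos hl])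
  have hd2 : |c| ≤ |c + l| + l := by
    have := abs_sub (c + l) l
    rwa [add_sub_cancel_right, abs_of_pos hl] at this
  rw [abs_le] at h1 h2
  rcases max_choice |c| |c + l| with h | h <;> rw [← hMdef] at h
  · have hlog : Real.log M = Real.log c := by rw [h, Real.log_abs]
    rw [← hlog]
    nlinarith
  · have hlog : Real.log M = Real.log (c + l) := by rw [h, Real.log_abs]
    rw [← hlog]
    nlinarith

lemma abs_logCusp_sub_le {M y : ℝ} (hy0 : y ≠ 0) (hy : |y| ≤ M) :
    |logCusp y - max 0 (-Real.log M)| ≤ Real.log M - Real.log y := by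
  have hpos : 0 < |y| := abs_pos.2 hy0
  have hmono : Real.log y ≤ Real.log M := by
    rw [← Real.log_abs y]
    exact Real.log_le_log hpos hy
  have hval : logCusp y = max 0 (-Real.log y) := by
    by_cases h : y ∈ Icc (-1 : ℝ) 1
    · rw [logCusp, indicator_of_mem h, max_eq_right]
      rw [← Real.log_abs y]
      exact neg_nonneg.2 (Real.log_nonpos hpos.le (abs_le.2 h))
    · rw [logCusp, indicator_of_notMem h, max_eq_left]
      rw [← Real.log_abs y]
      have : 1 < |y| := lt_of_not_ge fun hle => h (abs_le.1 hle)
      exact neg_nonpos.2 (Real.log_nonneg this.le)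
  rw [hval]
  refine (abs_max_sub_max_le_max 0 (-Real.log y) 0 (-Real.log M)).trans ?_
  rw [sub_self, abs_zero]
  refine max_le (sub_nonneg.2 hmono) ?_
  rw [neg_sub_neg, abs_of_nonneg (sub_nonneg.2 hmono)]

lemma integral_abs_logCusp_sub_le {c l : ℝ} (hl : 0 < l) :
    ∫ y in Icc c (c + l), |logCusp y - max 0 (-Real.log (max |c| |c + l|))| ≤ 2 * l := by
  refine le_trans (setIntegral_mono_on_ae ?_ ?_ measurableSet_Icc ?_) (integral_log_sub_log_le hl)
  · exact (integrable_logCusp.integrableOn.sub (integrableOn_const (by simp))).abs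
  · refine (integrableOn_const (by simp)).sub ?_
    rw [← intervalIntegrable_iff_integrableOn_Icc_of_le (by linarith)]
    exact intervalIntegral.intervalIntegrable_log'
  · filter_upwards [compl_mem_ae_iff.2 (measure_singleton (0 : ℝ))] with y hy hyJ
    exact abs_logCusp_sub_le hy (abs_le_max_abs_abs hyJ.1 hyJ.2)

lemma volume_square_toReal {a c l : ℝ} (hl : 0 < l) :
    (volume (square a c l)).toReal = l * l := by
  rw [square, Measure.volume_eq_prod, Measure.prod_prod]
  simp [hl.le]

lemma volume_square_ne_top (a c l : ℝ) : volume (square a c l) ≠ ⊤ :=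
  (isCompact_Icc.prod isCompact_Icc).measure_ne_top

lemma osc2_le_two_mul {b : ℝ × ℝ → ℝ} {a c l : ℝ} (hl : 0 < l)
    (hb : IntegrableOn b (square a c l)) (k : ℝ) :
    osc2 b a c l ≤ 2 * ((l * l)⁻¹ * ∫ p in square a c l, |b p - k|) := by
  have hvol := volume_square_toReal (a := a) (c := c) hl
  have hk (k : ℝ) : IntegrableOn (fun _ => k) (square a c l) :=
    integrableOn_const (volume_square_ne_top a c l)
  have hll : 0 < l * l := by positivity
  set A := avg2 b a c l with hA
  have hconst (k : ℝ) : ∫ _ in square a c l, k = l * l * k := by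
    rw [setIntegral_const, Measure.real, hvol, smul_eq_mul]
  have hAk : l * l * (k - A) = -∫ p in square a c l, (b p - k) := by
    rw [integral_sub hb (hk k), hconst, hA, avg2, hvol]
    field_simp
    ring
  have hmean : l * l * |k - A| ≤ ∫ p in square a c l, |b p - k| := by
    rw [← abs_of_pos hll, ← abs_mul, hAk, abs_neg]
    exact abs_integral_le_integral_abs
  have habs (k : ℝ) : IntegrableOn (fun p => |b p - k|) (square a c l) := (hb.sub (hk k)).abs
  have hmain : ∫ p in square a c l, |b p - A| ≤
      (∫ p in square a c l, |b p - k|) + l * l * |k - A| := by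
    rw [← hconst, ← integral_add (habs k) (hk _)]
    exact integral_mono (habs A) ((habs k).add (hk _)) fun p => abs_sub_le (b p) k A
  rw [osc2, hvol, mul_left_comm]
  exact mul_le_mul_of_nonneg_left (by linarith) (by positivity)

lemma osc2_le_of_abs_sub_le {b : ℝ × ℝ → ℝ} {a c l k K : ℝ} {g : ℝ → ℝ} (hl : 0 < l)
    (hb : IntegrableOn b (square a c l)) (hg : IntegrableOn g (Icc c (c + l)))
    (hbg : ∀ p ∈ square a c l, |b p - k| ≤ g p.2)
    (hK : ∫ y in Icc c (c + l), g y ≤ K * l) : osc2 b a c l ≤ 2 * K := by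
  have hone : IntegrableOn (fun _ : ℝ => (1 : ℝ)) (Icc a (a + l)) := integrableOn_const (by simp)
  have hgQ : IntegrableOn (fun p : ℝ × ℝ => g p.2) (square a c l) := by
    have := Integrable.mul_prod hone hg
    rw [Measure.prod_restrict] at this
    simp only [one_mul] at this
    exact this
  have hint : ∫ p in square a c l, |b p - k| ≤ l * (K * l) := by
    calc ∫ p in square a c l, |b p - k| ≤ ∫ p in square a c l, g p.2 :=
          setIntegral_mono_on (hb.sub (integrableOn_const (volume_square_ne_top a c l))).abs hgQ
            (measurableSet_Icc.prod measurableSet_Icc) hbg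
      _ = l * ∫ y in Icc c (c + l), g y := by
          have := setIntegral_prod_mul (μ := (volume : Measure ℝ)) (ν := (volume : Measure ℝ))
            (fun _ => (1 : ℝ)) g (Icc a (a + l)) (Icc c (c + l))
          rw [← Measure.volume_eq_prod] at this
          simpa [square, hl.le] using this
      _ ≤ l * (K * l) := mul_le_mul_of_nonneg_left hK hl.le
  refine (osc2_le_two_mul hl hb k).trans (mul_le_mul_of_nonneg_left ?_ zero_le_two)
  rw [inv_mul_le_iff₀ (by positivity)]
  linarith

/-- A bounded Lipschitz function of `x` times a function of `y` in `L¹ ∩ BMO`. -/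
def sinMulLogCusp (p : ℝ × ℝ) : ℝ := Real.sin p.1 * logCusp p.2

lemma integrableOn_sinMulLogCusp (u v s t : ℝ) :
    IntegrableOn sinMulLogCusp (Icc u v ×ˢ Icc s t) := by
  have hsin : IntegrableOn Real.sin (Icc u v) := Real.continuous_sin.integrableOn_Icc
  have := Integrable.mul_prod hsin (integrable_logCusp.integrableOn (s := Icc s t))
  rwa [Measure.prod_restrict] at this

lemma locallyIntegrable_sinMulLogCusp : LocallyIntegrable sinMulLogCusp := by
  refine locallyIntegrable_iff.2 fun K hK => ?_
  obtain ⟨r, hr⟩ := hK.isBounded.subset_closedBall ((0, 0) : ℝ × ℝ)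
  rw [← closedBall_prod_same, Real.closedBall_eq_Icc] at hr
  exact (integrableOn_sinMulLogCusp _ _ _ _).mono_set hr

lemma osc2_sinMulLogCusp_le {a c l : ℝ} (hl : 0 < l) :
    osc2 sinMulLogCusp a c l ≤ 2 * ((∫ y, |logCusp y|) + 2) := by
  have hQ := integrableOn_sinMulLogCusp a (a + l) c (c + l)
  have hψ : IntegrableOn (fun y => |logCusp y|) (Icc c (c + l)) :=
    integrable_logCusp.abs.integrableOn
  have hC : ∫ y in Icc c (c + l), |logCusp y| ≤ ∫ y, |logCusp y| :=
    setIntegral_le_integral integrable_logCusp.abs (ae_of_all _ fun _ => abs_nonneg _)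
  have hC0 : 0 ≤ ∫ y, |logCusp y| := integral_nonneg fun _ => abs_nonneg _
  rcases le_total 1 l with h1 | h1
  · refine osc2_le_of_abs_sub_le (k := 0) hl hQ hψ (fun p _ => ?_) (by nlinarith)
    rw [sub_zero, sinMulLogCusp, abs_mul]
    exact mul_le_of_le_one_left (abs_nonneg _) (Real.abs_sin_le_one _)
  · set m := max 0 (-Real.log (max |c| |c + l|)) with hm
    have hosc : IntegrableOn (fun y => |logCusp y - m|) (Icc c (c + l)) :=
      (integrable_logCusp.integrableOn.sub (integrableOn_const (by simp))).abs
    refine osc2_le_of_abs_sub_le (k := Real.sin a * m)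
      (g := fun y => l * |logCusp y| + |logCusp y - m|) hl hQ ((hψ.const_mul l).add hosc)
      (fun p hp => ?_) ?_
    · have hsin : |Real.sin p.1 - Real.sin a| ≤ l := by
        have hx := hp.1
        refine (Real.abs_sin_sub_sin_le _ _).trans ?_
        rw [abs_of_nonneg (by linarith [hx.1])]
        linarith [hx.2]
      calc |sinMulLogCusp p - Real.sin a * m|
          = |(Real.sin p.1 - Real.sin a) * logCusp p.2 + Real.sin a * (logCusp p.2 - m)| := by
            rw [sinMulLogCusp]
            ring_nf
        _ ≤ |Real.sin p.1 - Real.sin a| * |logCusp p.2| + |Real.sin a| * |logCusp p.2 - m| := by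
            rw [← abs_mul, ← abs_mul]
            exact abs_add_le _ _
        _ ≤ l * |logCusp p.2| + |logCusp p.2 - m| :=
            add_le_add (mul_le_mul_of_nonneg_right hsin (abs_nonneg _))
              (mul_le_of_le_one_left (abs_nonneg _) (Real.abs_sin_le_one _))
    · rw [integral_add (hψ.const_mul l) hosc, integral_const_mul]
      have := integral_abs_logCusp_sub_le (c := c) hl
      rw [← hm] at this
      nlinarith

lemma half_abs_le_osc1_sin_mul (k : ℝ) :
    |k| / 2 ≤ osc1 (fun x => Real.sin x * k) 0 (2 * Real.pi) := by
  have h2π : (0 : ℝ) ≤ 2 * Real.pi := by positivity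
  have havg : avg1 (fun x => Real.sin x * k) 0 (2 * Real.pi) = 0 := by
    rw [avg1, integral_Icc_eq_integral_Ioc, ← intervalIntegral.integral_of_le h2π,
      intervalIntegral.integral_mul_const, integral_sin]
    simp
  have hsq : Real.pi ≤ ∫ x in (0 : ℝ)..2 * Real.pi, |Real.sin x| := by
    have hval : ∫ x in (0 : ℝ)..2 * Real.pi, Real.sin x ^ 2 = Real.pi := by
      rw [integral_sin_sq]
      simp
    refine hval.ge.trans ?_
    have hcont_sq : Continuous fun x => Real.sin x ^ 2 := by fun_prop
    have hcont_abs : Continuous fun x => |Real.sin x| := by fun_prop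
    refine intervalIntegral.integral_mono_on h2π (hcont_sq.intervalIntegrable _ _)
      (hcont_abs.intervalIntegrable _ _) fun x _ => ?_
    rw [← sq_abs]
    nlinarith [abs_nonneg (Real.sin x), Real.abs_sin_le_one x]
  rw [osc1, havg, integral_Icc_eq_integral_Ioc, ← intervalIntegral.integral_of_le h2π]
  simp only [sub_zero, abs_mul, intervalIntegral.integral_mul_const]
  have hπ := Real.pi_pos
  calc |k| / 2 = (2 * Real.pi)⁻¹ * (Real.pi * |k|) := by field_simp
    _ ≤ _ := mul_le_mul_of_nonneg_left (mul_le_mul_of_nonneg_right hsq (abs_nonneg k))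
      (by positivity)

lemma ofReal_half_abs_logCusp_le_bmo1 (y : ℝ) :
    ENNReal.ofReal (|logCusp y| / 2) ≤ bmo1 fun x => sinMulLogCusp (x, y) :=
  (ENNReal.ofReal_le_ofReal (half_abs_le_osc1_sin_mul (logCusp y))).trans <|
    le_iSup_of_le 0 <| le_iSup_of_le (2 * Real.pi) <|
      le_iSup_of_le (by positivity) le_rfl

lemma bmoInf_sinMulLogCusp : bmoInf sinMulLogCusp = ⊤ := by
  by_contra hne
  obtain ⟨N, hN⟩ := ENNReal.exists_nat_gt hne
  have hae : ∀ᵐ y : ℝ, y ∉ Ioo 0 (Real.exp (-(2 * N))) := by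
    filter_upwards [ENNReal.ae_le_essSup
      fun y : ℝ => bmo1 fun x => sinMulLogCusp (x, y)] with y hy hyI
    have hlog : Real.log y < -(2 * N) := (Real.log_lt_iff_lt_exp hyI.1).2 hyI.2
    have hy1 : y ≤ 1 := hyI.2.le.trans (Real.exp_le_one_iff.2 (by simp))
    have hmem : y ∈ Icc (-1 : ℝ) 1 := ⟨by linarith [hyI.1], hy1⟩
    have hval : logCusp y = -Real.log y := indicator_of_mem hmem _
    have hle : (N : ℝ≥0∞) ≤ ENNReal.ofReal (|logCusp y| / 2) := by
      rw [← ENNReal.ofReal_natCast]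
      refine ENNReal.ofReal_le_ofReal ?_
      rw [hval]
      linarith [le_abs_self (-Real.log y)]
    exact absurd hN (not_lt.2 (hle.trans ((ofReal_half_abs_logCusp_le_bmo1 y).trans hy)))
  have hzero : volume (Ioo 0 (Real.exp (-(2 * N : ℝ)))) = 0 := by
    simpa only [ae_iff, not_not, ofPred_mem_eq] using hae
  rw [Real.volume_Ioo, ENNReal.ofReal_eq_zero, sub_zero] at hzero
  exact absurd hzero (not_le.2 (Real.exp_pos _))

/-- There is a locally integrable `b : ℝ² → ℝ` with `b ∈ BMO(ℝ²)` but
`‖b‖_{BMO,∞} = ess sup_y ‖b(·,y)‖_{BMO(ℝ)} = ∞`. -/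
theorem exists_planar_bmo_not_bmoInf :
    ∃ b : ℝ × ℝ → ℝ, LocallyIntegrable b volume ∧ bmo2 b < ⊤ ∧ bmoInf b = ⊤ := by
  refine ⟨sinMulLogCusp, locallyIntegrable_sinMulLogCusp, ?_, bmoInf_sinMulLogCusp⟩
  refine lt_of_le_of_lt ?_ (ENNReal.ofReal_lt_top (r := 2 * ((∫ y, |logCusp y|) + 2)))
  exact iSup_le fun a => iSup_le fun c => iSup_le fun l => iSup_le fun hl =>
    ENNReal.ofReal_le_ofReal (osc2_sinMulLogCusp_le hl)
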